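/- Let (V,X,Y,W,Z) be random variables on finite sets with joint distribution p(v,x,y,w,z). Then (V,W) satisfy H(f(X,Y,Z)|V,W,Z) = 0 together with the Markov chains V − X − (Y,W,Z) and (V,X,Z) − Y − W, if and only if X ∈ S_X(V) ∈ M(Γ(G_{X|Y,Z})), Y ∈ S_Y(W) ∈ M(Γ(G_{Y|S_X(V),Z})), and the Markov chains S_X(V) − X − (Y,S_Y(W),Z) and (S_X(V),X,Z) − Y − S_Y(W) hold. -/

import Mathlib

open Finset

attribute [local instance] Classical.propDecidable

noncomputable section

/-- Probability of an event under a probability mass function on a finite sample space. -/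
def pr {Ω : Type} [Fintype Ω] (μ : Ω → ℝ) (E : Set Ω) : ℝ :=
  ∑ ω, if ω ∈ E then μ ω else 0

/-- The distribution (law) of a random variable `X` under `μ`. -/
def law {Ω 𝒜 : Type} [Fintype Ω] (μ : Ω → ℝ) (X : Ω → 𝒜) : 𝒜 → ℝ :=
  fun a => pr μ {ω | X ω = a}

/-- Shannon entropy (base 2) of a discrete random variable. -/
def ent {Ω 𝒜 : Type} [Fintype Ω] [Fintype 𝒜] (μ : Ω → ℝ) (X : Ω → 𝒜) : ℝ :=
  -∑ a, law μ X a * Real.logb 2 (law μ X a)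

/-- Conditional entropy `H(X|Y) = H(X,Y) - H(Y)`. -/
def condEnt {Ω 𝒜 ℬ : Type} [Fintype Ω] [Fintype 𝒜] [Fintype ℬ]
    (μ : Ω → ℝ) (X : Ω → 𝒜) (Y : Ω → ℬ) : ℝ :=
  ent μ (fun ω => (X ω, Y ω)) - ent μ Y

/-- Mutual information `I(X;Y)`. -/
def mutInf {Ω 𝒜 ℬ : Type} [Fintype Ω] [Fintype 𝒜] [Fintype ℬ]
    (μ : Ω → ℝ) (X : Ω → 𝒜) (Y : Ω → ℬ) : ℝ :=
  ent μ X + ent μ Y - ent μ (fun ω => (X ω, Y ω))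

/-- Conditional mutual information `I(X;Y|Z)`. -/
def condMutInf {Ω 𝒜 ℬ 𝒞 : Type} [Fintype Ω] [Fintype 𝒜] [Fintype ℬ] [Fintype 𝒞]
    (μ : Ω → ℝ) (X : Ω → 𝒜) (Y : Ω → ℬ) (Z : Ω → 𝒞) : ℝ :=
  condEnt μ X Z + condEnt μ Y Z - condEnt μ (fun ω => (X ω, Y ω)) Z

/-- Markov chain `U − V − W`: `U` and `W` are conditionally independent given `V`. -/
def MarkovChain {Ω 𝒜 ℬ 𝒞 : Type} [Fintype Ω]
    (μ : Ω → ℝ) (U : Ω → 𝒜) (V : Ω → ℬ) (W : Ω → 𝒞) : Prop :=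
  ∀ a b c, pr μ {ω | U ω = a ∧ V ω = b ∧ W ω = c} * pr μ {ω | V ω = b}
    = pr μ {ω | U ω = a ∧ V ω = b} * pr μ {ω | V ω = b ∧ W ω = c}

/-- `⌈2^{nR}⌉`, the number of messages available at blocklength `n` and rate `R`. -/
def codeSize (n : ℕ) (R : ℝ) : ℕ := Nat.ceil ((2 : ℝ) ^ ((n : ℝ) * R))

/-- The i.i.d. product mass function on sequences of length `n`. -/
def iid {𝒜 : Type} (p : 𝒜 → ℝ) (n : ℕ) : (Fin n → 𝒜) → ℝ :=
  fun s => ∏ i, p (s i)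

/-- A rate pair `(RX, RY)` is achievable for computing `f` at a receiver knowing `Z`,
from separate encodings of `X` and `Y`, when `(X,Y,Z) ~ p` i.i.d. -/
def Achievable {𝒳 𝒴 𝒵 F : Type} [Fintype 𝒳] [Fintype 𝒴] [Fintype 𝒵] [Fintype F]
    (p : 𝒳 × 𝒴 × 𝒵 → ℝ) (f : 𝒳 → 𝒴 → 𝒵 → F) (RX RY : ℝ) : Prop :=
  ∀ ε : ℝ, 0 < ε → ∃ N : ℕ, ∀ n, N ≤ n →
    ∃ (φX : (Fin n → 𝒳) → Fin (codeSize n RX))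
      (φY : (Fin n → 𝒴) → Fin (codeSize n RY))
      (ψ : Fin (codeSize n RX) → Fin (codeSize n RY) → (Fin n → 𝒵) → (Fin n → F)),
      pr (iid p n)
        {s | ψ (φX fun i => (s i).1) (φY fun i => (s i).2.1) (fun i => (s i).2.2)
            ≠ fun i => f (s i).1 (s i).2.1 (s i).2.2} ≤ ε

/-- The rate region: the closure of the set of achievable rate pairs. -/
def RateRegion {𝒳 𝒴 𝒵 F : Type} [Fintype 𝒳] [Fintype 𝒴] [Fintype 𝒵] [Fintype F]
    (p : 𝒳 × 𝒴 × 𝒵 → ℝ) (f : 𝒳 → 𝒴 → 𝒵 → F) : Set (ℝ × ℝ) :=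
  closure {r | Achievable p f r.1 r.2}

/-- Conditional characteristic graph adjacency of `A` given `C`, w.r.t. joint
weights `q` and function `g`. -/
def charAdj {𝒜 𝒞 F : Type} (q : 𝒜 → 𝒞 → ℝ) (g : 𝒜 → 𝒞 → F) (a₁ a₂ : 𝒜) : Prop :=
  a₁ ≠ a₂ ∧ ∃ c, 0 < q a₁ c * q a₂ c ∧ g a₁ c ≠ g a₂ c

/-- Adjacency of the conditional characteristic graph `G_{X|Y,Z}`. -/
def adjXgYZ {𝒳 𝒴 𝒵 F : Type} (p : 𝒳 × 𝒴 × 𝒵 → ℝ) (f : 𝒳 → 𝒴 → 𝒵 → F) : 𝒳 → 𝒳 → Prop :=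
  charAdj (fun x (c : 𝒴 × 𝒵) => p (x, c.1, c.2)) (fun x c => f x c.1 c.2)

/-- Adjacency of the conditional characteristic graph `G_{Y|X,Z}`. -/
def adjYgXZ {𝒳 𝒴 𝒵 F : Type} (p : 𝒳 × 𝒴 × 𝒵 → ℝ) (f : 𝒳 → 𝒴 → 𝒵 → F) : 𝒴 → 𝒴 → Prop :=
  charAdj (fun y (c : 𝒳 × 𝒵) => p (c.1, y, c.2)) (fun y c => f c.1 y c.2)

/-- Adjacency of the conditional characteristic graph `G_{X,Y|Z}`. -/
def adjXYgZ {𝒳 𝒴 𝒵 F : Type} (p : 𝒳 × 𝒴 × 𝒵 → ℝ) (f : 𝒳 → 𝒴 → 𝒵 → F) :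
    (𝒳 × 𝒴) → (𝒳 × 𝒴) → Prop :=
  charAdj (fun a (z : 𝒵) => p (a.1, a.2, z)) (fun a z => f a.1 a.2 z)

/-- `s` is an independent set of the graph with adjacency `adj`. -/
def IndepFinset {𝒜 : Type} (adj : 𝒜 → 𝒜 → Prop) (s : Finset 𝒜) : Prop :=
  ∀ a₁ ∈ s, ∀ a₂ ∈ s, ¬ adj a₁ a₂

/-- `s` is a maximal independent set of the graph with adjacency `adj`. -/
def MaxIndepFinset {𝒜 : Type} (adj : 𝒜 → 𝒜 → Prop) (s : Finset 𝒜) : Prop :=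
  IndepFinset adj s ∧ ∀ t, IndepFinset adj t → s ⊆ t → t = s

/-- Adjacency of the generalized conditional characteristic graph `G_{Y|V,Z}` (a graph on
the values of `Y`): `y₁ ∼ y₂` iff they are distinct and there are `v, z` with
`p(v,y₁,z)·p(v,y₂,z) > 0` on which the function `f̃_X` (computed through the hidden
variable `X`) takes different values. -/
def genAdj {Ω 𝒱 𝒳 𝒴 𝒵 F : Type} [Fintype Ω] (μ : Ω → ℝ)
    (V : Ω → 𝒱) (X : Ω → 𝒳) (Y : Ω → 𝒴) (Z : Ω → 𝒵) (f : 𝒳 → 𝒴 → 𝒵 → F)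
    (y₁ y₂ : 𝒴) : Prop :=
  y₁ ≠ y₂ ∧ ∃ v z x₁ x₂,
    0 < pr μ {ω | V ω = v ∧ X ω = x₁ ∧ Y ω = y₁ ∧ Z ω = z} ∧
    0 < pr μ {ω | V ω = v ∧ X ω = x₂ ∧ Y ω = y₂ ∧ Z ω = z} ∧
    f x₁ y₁ z ≠ f x₂ y₂ z

/-- Conditional graph entropy `H_G(A|C)`: the infimum of `I(V;A|C)` over all joint
distributions `μ` of `(V,A,C)` whose `(A,C)`-marginal is `q`, satisfying the Markov
chain `V − A − C` with `A ∈ V ∈ Γ*(G)`. -/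
def condGraphEnt {𝒜 𝒞 : Type} [Fintype 𝒜] [Fintype 𝒞]
    (adj : 𝒜 → 𝒜 → Prop) (q : 𝒜 × 𝒞 → ℝ) : ℝ :=
  sInf { r : ℝ | ∃ μ : Finset 𝒜 × 𝒜 × 𝒞 → ℝ,
    (∀ a, 0 ≤ μ a) ∧ (∑ a, μ a = 1) ∧
    (∀ x c, (∑ v, μ (v, x, c)) = q (x, c)) ∧
    MarkovChain μ (fun a => a.1) (fun a => a.2.1) (fun a => a.2.2) ∧
    (∀ v x c, 0 < μ (v, x, c) → x ∈ v) ∧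
    (∀ v x c, 0 < μ (v, x, c) → MaxIndepFinset adj v) ∧
    r = condMutInf μ (fun a => a.1) (fun a => a.2.1) (fun a => a.2.2) }

/-- The support set `{x : p(v,x) > 0}` attached to an index `v` of `V`. -/
def suppSet {Ω 𝒱 𝒜 : Type} [Fintype Ω] [Fintype 𝒜] (μ : Ω → ℝ)
    (V : Ω → 𝒱) (X : Ω → 𝒜) (v : 𝒱) : Finset 𝒜 :=
  Finset.univ.filter (fun x => 0 < pr μ {ω | V ω = v ∧ X ω = x})

/-- The support-set random variable `S_X(V) = (V, {x : p(V,x) > 0})`. -/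
def suppVar {Ω 𝒱 𝒜 : Type} [Fintype Ω] [Fintype 𝒜] (μ : Ω → ℝ)
    (V : Ω → 𝒱) (X : Ω → 𝒜) : Ω → 𝒱 × Finset 𝒜 :=
  fun ω => (V ω, suppSet μ V X (V ω))

section Pr

variable {Ω 𝒜 ℬ 𝒞 : Type} [Fintype Ω] {μ : Ω → ℝ}

lemma pr_nonneg (hμ : ∀ ω, 0 ≤ μ ω) (E : Set Ω) : 0 ≤ pr μ E :=
  Finset.sum_nonneg fun ω _ => by split_ifs <;> simp [hμ ω]

lemma pr_pos_iff (hμ : ∀ ω, 0 ≤ μ ω) (E : Set Ω) : 0 < pr μ E ↔ ∃ ω ∈ E, 0 < μ ω := by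
  unfold pr
  rw [Finset.sum_pos_iff_of_nonneg fun ω _ => by split_ifs <;> simp [hμ ω]]
  refine exists_congr fun ω => ?_
  by_cases h : ω ∈ E <;> simp [h]

lemma pr_mono (hμ : ∀ ω, 0 ≤ μ ω) {E E' : Set Ω} (h : E ⊆ E') : pr μ E ≤ pr μ E' :=
  Finset.sum_le_sum fun ω _ => by
    by_cases h1 : ω ∈ E
    · simp [h1, h h1]
    · by_cases h2 : ω ∈ E' <;> simp [h1, h2, hμ ω]

lemma pr_congr_ae (hμ : ∀ ω, 0 ≤ μ ω) {E E' : Set Ω}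
    (h : ∀ ω, 0 < μ ω → (ω ∈ E ↔ ω ∈ E')) : pr μ E = pr μ E' :=
  Finset.sum_congr rfl fun ω _ => by
    rcases (hμ ω).eq_or_lt with h0 | h0
    · simp [← h0]
    · simp [h ω h0]

lemma pr_diff {E E' : Set Ω} (h : E ⊆ E') : pr μ (E' \ E) = pr μ E' - pr μ E := by
  simp only [pr, ← Finset.sum_sub_distrib]
  refine Finset.sum_congr rfl fun ω _ => ?_
  by_cases h1 : ω ∈ E
  · simp [h1, h h1]
  · simp [h1]

lemma pr_eq_one (hμ : ∀ ω, 0 ≤ μ ω) (hμ1 : ∑ ω, μ ω = 1) {E : Set Ω}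
    (h : ∀ ω, 0 < μ ω → ω ∈ E) : pr μ E = 1 := by
  rw [pr_congr_ae hμ (E' := Set.univ) fun ω hω => by simp [h ω hω]]
  simpa [pr] using hμ1

lemma ent_eq_sum [Fintype 𝒜] (X : Ω → 𝒜) :
    ent μ X = -∑ ω, μ ω * Real.logb 2 (law μ X (X ω)) := by
  unfold ent
  congr 1
  conv_lhs =>
    enter [2, a]
    rw [law, pr, Finset.sum_mul]
  rw [Finset.sum_comm]
  refine Finset.sum_congr rfl fun ω _ => ?_
  rw [Finset.sum_eq_single (X ω)]
  · simp [law, pr]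
  · intro a _ ha
    simp [Ne.symm ha]
  · simp

/-- `H(X|Y) = 0` iff, almost surely, `Y` determines `X`. -/
lemma condEnt_eq_zero_iff (hμ : ∀ ω, 0 ≤ μ ω) [Fintype 𝒜] [Fintype ℬ]
    (X : Ω → 𝒜) (Y : Ω → ℬ) :
    condEnt μ X Y = 0 ↔ ∀ ω ω', 0 < μ ω → 0 < μ ω' → Y ω = Y ω' → X ω = X ω' := by
  set E : Ω → Set Ω := fun ω => {ω' | (X ω', Y ω') = (X ω, Y ω)}
  set E' : Ω → Set Ω := fun ω => {ω' | Y ω' = Y ω}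
  have hE : ∀ ω, E ω ⊆ E' ω := fun ω ω' h => (Prod.mk.inj h).2
  have hpos : ∀ ω, 0 < μ ω → 0 < pr μ (E ω) := fun ω hω => (pr_pos_iff hμ _).2 ⟨ω, rfl, hω⟩
  have hsum : condEnt μ X Y =
      ∑ ω, μ ω * (Real.logb 2 (pr μ (E' ω)) - Real.logb 2 (pr μ (E ω))) := by
    simp only [condEnt, ent_eq_sum, mul_sub, Finset.sum_sub_distrib, law, E, E']
    ring
  have hterm : ∀ ω ∈ Finset.univ,
      0 ≤ μ ω * (Real.logb 2 (pr μ (E' ω)) - Real.logb 2 (pr μ (E ω))) := fun ω _ => by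
    rcases (hμ ω).eq_or_lt with h0 | h0
    · simp [← h0]
    · exact mul_nonneg h0.le (sub_nonneg.2
        (Real.logb_le_logb_of_le one_lt_two (hpos ω h0) (pr_mono hμ (hE ω))))
  have hpoint : ∀ ω, 0 < μ ω →
      (μ ω * (Real.logb 2 (pr μ (E' ω)) - Real.logb 2 (pr μ (E ω))) = 0 ↔
        ∀ ω', 0 < μ ω' → Y ω = Y ω' → X ω = X ω') := fun ω hω => by
    have hinj : Real.logb 2 (pr μ (E' ω)) = Real.logb 2 (pr μ (E ω)) ↔
        pr μ (E' ω) = pr μ (E ω) :=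
      (Real.logb_injOn_pos one_lt_two).eq_iff
        ((hpos ω hω).trans_le (pr_mono hμ (hE ω))) (hpos ω hω)
    rw [mul_eq_zero_iff_left hω.ne', sub_eq_zero, hinj, ← sub_eq_zero, ← pr_diff (hE ω),
      ← (pr_nonneg hμ _).not_lt_iff_eq', pr_pos_iff hμ]
    constructor
    · intro h ω' hω' hY
      by_contra hX
      exact h ⟨ω', ⟨hY.symm, fun hm => hX (Prod.mk.inj hm).1.symm⟩, hω'⟩
    · rintro h ⟨ω', ⟨hY, hX⟩, hω'⟩
      exact hX (Prod.ext (h ω' hω' (Eq.symm hY)).symm hY)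
  rw [hsum, Finset.sum_eq_zero_iff_of_nonneg hterm]
  constructor
  · exact fun h ω ω' hω => (hpoint ω hω).1 (h ω (Finset.mem_univ ω)) ω'
  · intro h ω _
    rcases (hμ ω).eq_or_lt with h0 | h0
    · simp [← h0]
    · exact (hpoint ω h0).2 fun ω' => h ω ω' h0

lemma MarkovChain.symm {U : Ω → 𝒜} {V : Ω → ℬ} {W : Ω → 𝒞} (h : MarkovChain μ U V W) :
    MarkovChain μ W V U := fun c b a => by
  have := h a b c
  simp only [and_comm, and_assoc] at this ⊢
  linarith

lemma markovChain_comm {U : Ω → 𝒜} {V : Ω → ℬ} {W : Ω → 𝒞} :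
    MarkovChain μ U V W ↔ MarkovChain μ W V U :=
  ⟨MarkovChain.symm, MarkovChain.symm⟩

lemma markovChain_comp_left {𝒜' : Type} {U : Ω → 𝒜} {V : Ω → ℬ} {W : Ω → 𝒞} {g : 𝒜 → 𝒜'}
    (hg : Function.Injective g) :
    MarkovChain μ (fun ω => g (U ω)) V W ↔ MarkovChain μ U V W := by
  constructor
  · intro h a b c
    simpa only [hg.eq_iff] using h (g a) b c
  · intro h a' b c
    by_cases ha : ∃ a, g a = a'
    · obtain ⟨a, rfl⟩ := ha
      simpa only [hg.eq_iff] using h a b c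
    · have hU : ∀ ω, g (U ω) ≠ a' := fun ω hω => ha ⟨_, hω⟩
      simp [hU, pr]

lemma markovChain_comp_right {𝒞' : Type} {U : Ω → 𝒜} {V : Ω → ℬ} {W : Ω → 𝒞} {g : 𝒞 → 𝒞'}
    (hg : Function.Injective g) :
    MarkovChain μ U V (fun ω => g (W ω)) ↔ MarkovChain μ U V W := by
  rw [markovChain_comm, markovChain_comp_left hg, markovChain_comm]

/-- Along a Markov chain `U − V − W`, a possible pair `(u, v)` and a possible pair `(v, w)`
occur jointly with positive probability. -/
lemma MarkovChain.exists_pos (hμ : ∀ ω, 0 ≤ μ ω) {U : Ω → 𝒜} {V : Ω → ℬ} {W : Ω → 𝒞}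
    (h : MarkovChain μ U V W) {ω₁ ω₂ : Ω} (h₁ : 0 < μ ω₁) (h₂ : 0 < μ ω₂) (hV : V ω₁ = V ω₂) :
    ∃ ω, 0 < μ ω ∧ U ω = U ω₁ ∧ V ω = V ω₁ ∧ W ω = W ω₂ := by
  have hUV : 0 < pr μ {ω | U ω = U ω₁ ∧ V ω = V ω₁} :=
    (pr_pos_iff hμ _).2 ⟨ω₁, ⟨rfl, rfl⟩, h₁⟩
  have hVW : 0 < pr μ {ω | V ω = V ω₁ ∧ W ω = W ω₂} :=
    (pr_pos_iff hμ _).2 ⟨ω₂, ⟨hV.symm, rfl⟩, h₂⟩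
  have hpos := pos_of_mul_pos_left
    ((h (U ω₁) (V ω₁) (W ω₂)).symm ▸ mul_pos hUV hVW) (pr_nonneg hμ _)
  obtain ⟨ω, ⟨hU, hV', hW⟩, hω⟩ := (pr_pos_iff hμ _).1 hpos
  exact ⟨ω, hω, hU, hV', hW⟩

lemma mem_suppSet [Fintype 𝒜] (hμ : ∀ ω, 0 ≤ μ ω) {V : Ω → ℬ} {X : Ω → 𝒜} {v : ℬ} {x : 𝒜} :
    x ∈ suppSet μ V X v ↔ ∃ ω, 0 < μ ω ∧ V ω = v ∧ X ω = x := by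
  simp only [suppSet, Finset.mem_filter, Finset.mem_univ, true_and, pr_pos_iff hμ,
    Set.mem_ofPred_eq]
  exact exists_congr fun ω => and_comm

lemma pr_mem_suppVar_eq_one [Fintype 𝒜] (hμ : ∀ ω, 0 ≤ μ ω) (hμ1 : ∑ ω, μ ω = 1)
    (V : Ω → ℬ) (X : Ω → 𝒜) : pr μ {ω | X ω ∈ (suppVar μ V X ω).2} = 1 :=
  pr_eq_one hμ hμ1 fun ω hω => (mem_suppSet hμ).2 ⟨ω, hω, rfl, rfl⟩

end Pr

section Independence

variable {Ω 𝒱 𝒳 𝒴 𝒲 𝒵 F : Type} [Fintype Ω] {μ : Ω → ℝ}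

lemma indepFinset_adjXgYZ_suppSet_iff [Fintype 𝒳] [Fintype 𝒴] [Fintype 𝒵]
    (hμ : ∀ ω, 0 ≤ μ ω) (V : Ω → 𝒱) (X : Ω → 𝒳) (Y : Ω → 𝒴) (Z : Ω → 𝒵) (f : 𝒳 → 𝒴 → 𝒵 → F) :
    (∀ v, IndepFinset (adjXgYZ (law μ fun ω => (X ω, Y ω, Z ω)) f) (suppSet μ V X v)) ↔
      ∀ ω₁ ω₂ ω₃ ω₄, 0 < μ ω₁ → 0 < μ ω₂ → 0 < μ ω₃ → 0 < μ ω₄ → V ω₁ = V ω₂ →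
        X ω₁ = X ω₃ → X ω₂ = X ω₄ → Y ω₃ = Y ω₄ → Z ω₃ = Z ω₄ →
        f (X ω₃) (Y ω₃) (Z ω₃) = f (X ω₄) (Y ω₄) (Z ω₄) := by
  have hlaw : ∀ a, 0 ≤ law μ (fun ω => (X ω, Y ω, Z ω)) a := fun a => pr_nonneg hμ _
  constructor
  · intro h ω₁ ω₂ ω₃ ω₄ h₁ h₂ h₃ h₄ hV hX₁ hX₂ hY hZ
    by_contra hf
    refine h (V ω₁) (X ω₃) ((mem_suppSet hμ).2 ⟨ω₁, h₁, rfl, hX₁⟩) (X ω₄)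
      ((mem_suppSet hμ).2 ⟨ω₂, h₂, hV.symm, hX₂⟩)
      ⟨fun hX => hf (by rw [hX, hY, hZ]), (Y ω₃, Z ω₃), mul_pos ?_ ?_, ?_⟩
    · exact (pr_pos_iff hμ _).2 ⟨ω₃, rfl, h₃⟩
    · exact (pr_pos_iff hμ _).2 ⟨ω₄, by simp [hY, hZ], h₄⟩
    · simpa only [hY, hZ] using hf
  · rintro h v x₁ hx₁ x₂ hx₂ ⟨-, ⟨y, z⟩, hpos, hf⟩
    obtain ⟨ω₁, h₁, rfl, rfl⟩ := (mem_suppSet hμ).1 hx₁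
    obtain ⟨ω₂, h₂, hV, rfl⟩ := (mem_suppSet hμ).1 hx₂
    obtain ⟨ω₃, hm₃, h₃⟩ := (pr_pos_iff hμ _).1 (pos_of_mul_pos_left hpos (hlaw _))
    obtain ⟨ω₄, hm₄, h₄⟩ := (pr_pos_iff hμ _).1 (pos_of_mul_pos_right hpos (hlaw _))
    simp only [Set.mem_ofPred_eq, Prod.mk.injEq] at hm₃ hm₄
    obtain ⟨hX₃, rfl, rfl⟩ := hm₃
    obtain ⟨hX₄, hY₄, hZ₄⟩ := hm₄
    have := h ω₁ ω₂ ω₃ ω₄ h₁ h₂ h₃ h₄ hV.symm hX₃.symm hX₄.symm hY₄.symm hZ₄.symm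
    rw [hX₃, hX₄, hY₄, hZ₄] at this
    exact hf this

lemma indepFinset_genAdj_suppSet_iff [Fintype 𝒳] [Fintype 𝒴]
    (hμ : ∀ ω, 0 ≤ μ ω) (V : Ω → 𝒱) (X : Ω → 𝒳) (Y : Ω → 𝒴) (W : Ω → 𝒲) (Z : Ω → 𝒵)
    (f : 𝒳 → 𝒴 → 𝒵 → F) :
    (∀ w, IndepFinset (genAdj μ (suppVar μ V X) X Y Z f) (suppSet μ W Y w)) ↔
      ∀ ω₁ ω₂ ω₃ ω₄, 0 < μ ω₁ → 0 < μ ω₂ → 0 < μ ω₃ → 0 < μ ω₄ → W ω₁ = W ω₂ →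
        Y ω₁ = Y ω₃ → Y ω₂ = Y ω₄ → Y ω₃ ≠ Y ω₄ → V ω₃ = V ω₄ → Z ω₃ = Z ω₄ →
        f (X ω₃) (Y ω₃) (Z ω₃) = f (X ω₄) (Y ω₄) (Z ω₄) := by
  constructor
  · intro h ω₁ ω₂ ω₃ ω₄ h₁ h₂ h₃ h₄ hW hY₁ hY₂ hY hV hZ
    by_contra hf
    refine h (W ω₁) (Y ω₃) ((mem_suppSet hμ).2 ⟨ω₁, h₁, rfl, hY₁⟩) (Y ω₄)
      ((mem_suppSet hμ).2 ⟨ω₂, h₂, hW.symm, hY₂⟩)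
      ⟨hY, suppVar μ V X ω₃, Z ω₃, X ω₃, X ω₄, ?_, ?_, ?_⟩
    · exact (pr_pos_iff hμ _).2 ⟨ω₃, ⟨rfl, rfl, rfl, rfl⟩, h₃⟩
    · exact (pr_pos_iff hμ _).2 ⟨ω₄, ⟨by simp [suppVar, hV], rfl, rfl, hZ.symm⟩, h₄⟩
    · simpa only [hZ] using hf
  · rintro h w y₁ hy₁ y₂ hy₂ ⟨hne, v, z, x₁, x₂, hpos₁, hpos₂, hf⟩
    obtain ⟨ω₁, h₁, rfl, rfl⟩ := (mem_suppSet hμ).1 hy₁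
    obtain ⟨ω₂, h₂, hW, rfl⟩ := (mem_suppSet hμ).1 hy₂
    obtain ⟨ω₃, ⟨rfl, rfl, hY₃, rfl⟩, h₃⟩ := (pr_pos_iff hμ _).1 hpos₁
    obtain ⟨ω₄, ⟨hV₄, rfl, hY₄, hZ₄⟩, h₄⟩ := (pr_pos_iff hμ _).1 hpos₂
    have := h ω₁ ω₂ ω₃ ω₄ h₁ h₂ h₃ h₄ hW.symm hY₃.symm hY₄.symm (hY₃ ▸ hY₄ ▸ hne)
      (Prod.mk.inj hV₄).1.symm hZ₄.symm
    rw [hY₃, hY₄, hZ₄] at this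
    exact hf this

/-- Given the two Markov chains, `f(X,Y,Z)` is determined by `(V,W,Z)` iff the support sets
are independent in the (generalized) conditional characteristic graphs. -/
lemma condEnt_eq_zero_iff_indepFinset [Fintype 𝒱] [Fintype 𝒳] [Fintype 𝒴] [Fintype 𝒲]
    [Fintype 𝒵] [Fintype F] (hμ : ∀ ω, 0 ≤ μ ω) {V : Ω → 𝒱} {X : Ω → 𝒳} {Y : Ω → 𝒴}
    {W : Ω → 𝒲} {Z : Ω → 𝒵} {f : 𝒳 → 𝒴 → 𝒵 → F}
    (hVX : MarkovChain μ V X fun ω => (Y ω, W ω, Z ω))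
    (hYW : MarkovChain μ (fun ω => (V ω, X ω, Z ω)) Y W) :
    condEnt μ (fun ω => f (X ω) (Y ω) (Z ω)) (fun ω => (V ω, W ω, Z ω)) = 0 ↔
      (∀ v, IndepFinset (adjXgYZ (law μ fun ω => (X ω, Y ω, Z ω)) f) (suppSet μ V X v)) ∧
      ∀ w, IndepFinset (genAdj μ (suppVar μ V X) X Y Z f) (suppSet μ W Y w) := by
  rw [condEnt_eq_zero_iff hμ, indepFinset_adjXgYZ_suppSet_iff hμ,
    indepFinset_genAdj_suppSet_iff hμ]
  constructor
  · intro h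
    constructor
    · intro ω₁ ω₂ ω₃ ω₄ h₁ h₂ h₃ h₄ hV hX₁ hX₂ hY hZ
      obtain ⟨ω, hω, hVω, hXω, hW⟩ := hVX.exists_pos hμ h₁ h₃ hX₁
      obtain ⟨ω', hω', hVω', hXω', hW'⟩ := hVX.exists_pos hμ h₂ h₄ hX₂
      obtain ⟨ω'', hω'', hU, hY'', hW''⟩ := hYW.exists_pos hμ hω' hω
        (by simp_all)
      simp only [Prod.mk.injEq] at hW hW' hU
      have := h ω ω'' hω hω'' (by simp_all)
      simp_all
    · intro ω₁ ω₂ ω₃ ω₄ h₁ h₂ h₃ h₄ hW hY₁ hY₂ _ hV hZ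
      obtain ⟨ω, hω, hU, hY, hWω⟩ := hYW.exists_pos hμ h₃ h₁ hY₁.symm
      obtain ⟨ω', hω', hU', hY', hW'⟩ := hYW.exists_pos hμ h₄ h₂ hY₂.symm
      simp only [Prod.mk.injEq] at hU hU'
      have := h ω ω' hω hω' (by simp_all)
      simp_all
  · rintro ⟨hX, hY⟩ ω ω' hω hω' hVWZ
    simp only [Prod.mk.injEq] at hVWZ
    obtain ⟨hV, hW, hZ⟩ := hVWZ
    by_cases hYY : Y ω = Y ω'
    · exact hX ω ω' ω ω' hω hω' hω hω' hV rfl rfl hYY hZ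
    · exact hY ω ω' ω ω' hω hω' hω hω' hW rfl rfl hYY hV hZ

end Independence

/-- Lemma 3: for `(V,X,Y,W,Z) ~ p` on the canonical sample space,
`H(f(X,Y,Z)|V,W,Z) = 0` together with the Markov chains `V − X − (Y,W,Z)` and
`(V,X,Z) − Y − W` holds iff `X ∈ S_X(V) ∈ M(Γ(G_{X|Y,Z}))`,
`Y ∈ S_Y(W) ∈ M(Γ(G_{Y|S_X(V),Z}))`, and the Markov chains
`S_X(V) − X − (Y,S_Y(W),Z)` and `(S_X(V),X,Z) − Y − S_Y(W)` hold. -/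
theorem zero_entropy_markov_iff_support_sets
    (𝒱 𝒳 𝒴 𝒲 𝒵 F : Type)
    [Fintype 𝒱] [Fintype 𝒳] [Fintype 𝒴] [Fintype 𝒲] [Fintype 𝒵] [Fintype F]
    (p : 𝒱 × 𝒳 × 𝒴 × 𝒲 × 𝒵 → ℝ) (hp0 : ∀ a, 0 ≤ p a) (hp1 : ∑ a, p a = 1)
    (f : 𝒳 → 𝒴 → 𝒵 → F) :
    (condEnt p (fun a => f a.2.1 a.2.2.1 a.2.2.2.2)
        (fun a => (a.1, a.2.2.2.1, a.2.2.2.2)) = 0 ∧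
      MarkovChain p (fun a => a.1) (fun a => a.2.1)
        (fun a => (a.2.2.1, a.2.2.2.1, a.2.2.2.2)) ∧
      MarkovChain p (fun a => (a.1, a.2.1, a.2.2.2.2)) (fun a => a.2.2.1)
        (fun a => a.2.2.2.1))
    ↔
    -- X ∈ S_X(V)
    (pr p {a | a.2.1 ∈ (suppVar p (fun b => b.1) (fun b => b.2.1) a).2} = 1 ∧
      -- S_X(V) ∈ M(Γ(G_{X|Y,Z}))
      (∀ v, IndepFinset
        (adjXgYZ (law p (fun a => (a.2.1, a.2.2.1, a.2.2.2.2))) f)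
        (suppSet p (fun a => a.1) (fun a => a.2.1) v)) ∧
      -- Y ∈ S_Y(W)
      pr p {a | a.2.2.1 ∈ (suppVar p (fun b => b.2.2.2.1) (fun b => b.2.2.1) a).2} = 1 ∧
      -- S_Y(W) ∈ M(Γ(G_{Y|S_X(V),Z}))
      (∀ w, IndepFinset
        (genAdj p (suppVar p (fun a => a.1) (fun a => a.2.1))
          (fun a => a.2.1) (fun a => a.2.2.1) (fun a => a.2.2.2.2) f)
        (suppSet p (fun a => a.2.2.2.1) (fun a => a.2.2.1) w)) ∧
      -- S_X(V) − X − (Y, S_Y(W), Z)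
      MarkovChain p (suppVar p (fun a => a.1) (fun a => a.2.1)) (fun a => a.2.1)
        (fun a => (a.2.2.1, suppVar p (fun b => b.2.2.2.1) (fun b => b.2.2.1) a,
          a.2.2.2.2)) ∧
      -- (S_X(V), X, Z) − Y − S_Y(W)
      MarkovChain p
        (fun a => (suppVar p (fun b => b.1) (fun b => b.2.1) a, a.2.1, a.2.2.2.2))
        (fun a => a.2.2.1)
        (suppVar p (fun a => a.2.2.2.1) (fun a => a.2.2.1))) := by
  have hV : Function.Injective fun v => (v, suppSet p (fun a => a.1) (fun a => a.2.1) v) :=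
    fun v v' h => (Prod.mk.inj h).1
  have hW : Function.Injective fun w =>
      (w, suppSet p (fun a => a.2.2.2.1) (fun a => a.2.2.1) w) :=
    fun w w' h => (Prod.mk.inj h).1
  have hYWZ : Function.Injective fun c : 𝒴 × 𝒲 × 𝒵 =>
      (c.1, (c.2.1, suppSet p (fun a => a.2.2.2.1) (fun a => a.2.2.1) c.2.1), c.2.2) :=
    fun c c' h => by simp_all [Prod.ext_iff]
  have hVXZ : Function.Injective fun c : 𝒱 × 𝒳 × 𝒵 =>
      ((c.1, suppSet p (fun a => a.1) (fun a => a.2.1) c.1), c.2) :=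
    fun c c' h => by simp_all [Prod.ext_iff]
  have hVX := (markovChain_comp_left (μ := p) (U := fun a => a.1) (V := fun a => a.2.1)
    (W := fun a : 𝒱 × 𝒳 × 𝒴 × 𝒲 × 𝒵 =>
      (a.2.2.1, suppVar p (fun b => b.2.2.2.1) (fun b => b.2.2.1) a,
        a.2.2.2.2)) hV).trans
    (markovChain_comp_right
      (W := fun a : 𝒱 × 𝒳 × 𝒴 × 𝒲 × 𝒵 => (a.2.2.1, a.2.2.2.1, a.2.2.2.2)) hYWZ)
  have hYW := (markovChain_comp_left (μ := p)
    (U := fun a : 𝒱 × 𝒳 × 𝒴 × 𝒲 × 𝒵 => (a.1, a.2.1, a.2.2.2.2))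
    (V := fun a => a.2.2.1)
    (W := suppVar p (fun a => a.2.2.2.1) (fun a => a.2.2.1)) hVXZ).trans
    (markovChain_comp_right (W := fun a : 𝒱 × 𝒳 × 𝒴 × 𝒲 × 𝒵 => a.2.2.2.1) hW)
  constructor
  · rintro ⟨hent, h₁, h₂⟩
    obtain ⟨hX, hY⟩ := (condEnt_eq_zero_iff_indepFinset hp0 h₁ h₂).1 hent
    exact ⟨pr_mem_suppVar_eq_one hp0 hp1 _ _, hX, pr_mem_suppVar_eq_one hp0 hp1 _ _, hY,
      hVX.2 h₁, hYW.2 h₂⟩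
  · rintro ⟨-, hX, -, hY, h₁, h₂⟩
    have h₁' := hVX.1 h₁
    have h₂' := hYW.1 h₂
    exact ⟨(condEnt_eq_zero_iff_indepFinset hp0 h₁' h₂').2 ⟨hX, hY⟩, h₁', h₂'⟩
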